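/- arXiv:1604.01620 — 2 statements merged into one kernel-verified Lean document; each statement's English description precedes it below -/
import Mathlib

section
/- Let F and G be two distribution functions on ℝ satisfying F̄(x) > 0 and Ḡ(x) > 0 for all x ∈ ℝ. Then for all x ∈ ℝ, v ∈ ℝ, and t > 0, the tail of the convolution satisfies (F∗G)‾(x−t)/(F∗G)‾(x) ≤ max{ sup_{y ≥ v} F̄(y−t)/F̄(y), sup_{y ≥ x−v+t} Ḡ(y−t)/Ḡ(y) }. -/
open MeasureTheory ProbabilityTheory Filter

noncomputable section

/-- A pointwise bound on the sections `{b | (a, b) ∈ A}` integrates to the product measure. -/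
lemma prod_le_mul_of_section_le {α β : Type*} [MeasurableSpace α] [MeasurableSpace β]
    {μ : Measure α} {ν : Measure β} [SFinite ν] {A B : Set (α × β)}
    (hA : MeasurableSet A) (hB : MeasurableSet B) {M : ENNReal}
    (h : ∀ a, ν (Prod.mk a ⁻¹' A) ≤ M * ν (Prod.mk a ⁻¹' B)) :
    μ.prod ν A ≤ M * μ.prod ν B := by
  rw [Measure.prod_apply hA, Measure.prod_apply hB,
    ← lintegral_const_mul M (measurable_measure_prodMk_left hB)]
  exact lintegral_mono h

/-- A pointwise bound on the sections `{a | (a, b) ∈ A}` integrates to the product measure. -/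
lemma prod_le_mul_of_section_le_symm {α β : Type*} [MeasurableSpace α] [MeasurableSpace β]
    {μ : Measure α} {ν : Measure β} [SFinite μ] [SFinite ν] {A B : Set (α × β)}
    (hA : MeasurableSet A) (hB : MeasurableSet B) {M : ENNReal}
    (h : ∀ b, μ ((fun a => (a, b)) ⁻¹' A) ≤ M * μ ((fun a => (a, b)) ⁻¹' B)) :
    μ.prod ν A ≤ M * μ.prod ν B := by
  rw [Measure.prod_apply_symm hA, Measure.prod_apply_symm hB,
    ← lintegral_const_mul M (measurable_measure_prodMk_right hB)]
  exact lintegral_mono h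

/-- If `M` bounds the ratio of the tails of `μ` at `y - t` and `y` for `y ≥ v`, and that of `ν` for
`y ≥ x - v + t`, then it bounds the ratio of the tails of their convolution at `x - t` and `x`. -/
lemma prod_tail_sum_le_mul {μ ν : Measure ℝ} [SFinite μ] [SFinite ν] {x v t : ℝ}
    {M : ENNReal} (hM : 1 ≤ M)
    (hμ : ∀ y, v ≤ y → μ (Set.Ioi (y - t)) ≤ M * μ (Set.Ioi y))
    (hν : ∀ y, x - v + t ≤ y → ν (Set.Ioi (y - t)) ≤ M * ν (Set.Ioi y)) :
    μ.prod ν {p | x - t < p.1 + p.2} ≤ M * μ.prod ν {p | x < p.1 + p.2} := by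
  have hs (z : ℝ) : MeasurableSet {p : ℝ × ℝ | z < p.1 + p.2} :=
    measurableSet_lt measurable_const (measurable_fst.add measurable_snd)
  have hC : MeasurableSet {p : ℝ × ℝ | p.2 ≤ x - v} :=
    measurableSet_le measurable_snd measurable_const
  rw [← measure_inter_add_sdiff _ hC,
    ← measure_inter_add_sdiff {p : ℝ × ℝ | x < p.1 + p.2} hC, mul_add]
  refine add_le_add
    (prod_le_mul_of_section_le_symm ((hs _).inter hC) ((hs _).inter hC) fun u => ?_)
    (prod_le_mul_of_section_le ((hs _).diff hC) ((hs _).diff hC) fun s => ?_)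
  · by_cases hu : u ≤ x - v
    · convert hμ (x - u) (by linarith) using 3
      · ext s
        simp only [Set.mem_preimage, Set.mem_inter_iff, Set.mem_ofPred_eq, Set.mem_Ioi]
        grind
      · ext s
        simp only [Set.mem_preimage, Set.mem_inter_iff, Set.mem_ofPred_eq, Set.mem_Ioi]
        grind
    · refine (measure_mono_null (fun s hs => hu hs.2) measure_empty).trans_le zero_le
  · rcases le_or_gt v s with hvs | hsv
    · refine (measure_mono fun u hu => ?_).trans (le_mul_of_one_le_left zero_le hM)
      simp only [Set.mem_preimage, Set.mem_sdiff, Set.mem_ofPred_eq] at hu ⊢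
      grind
    · have key : ν (Set.Ioi (max (x - v) (x - s - t))) ≤ M * ν (Set.Ioi (x - s)) := by
        refine le_trans (measure_mono (Set.Ioi_subset_Ioi ?_))
          ((hν (max (x - v + t) (x - s)) (le_max_left _ _)).trans
            (mul_le_mul_right (measure_mono (Set.Ioi_subset_Ioi (le_max_right _ _))) M))
        grind
      convert key using 3
      · ext u
        simp only [Set.mem_preimage, Set.mem_sdiff, Set.mem_ofPred_eq, Set.mem_Ioi]
        grind
      · ext u
        simp only [Set.mem_preimage, Set.mem_sdiff, Set.mem_ofPred_eq, Set.mem_Ioi]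
        grind

/-- Lemma of Embrechts–Goldie: for independent `X` and `Y` with everywhere positive tails,
the tail of the distribution of the sum (i.e. of the convolution `F∗G` of their distribution
functions) satisfies, for all `x, v ∈ ℝ` and `t > 0`,
`(F∗G)‾(x−t)/(F∗G)‾(x) ≤ max { sup_{y ≥ v} F̄(y−t)/F̄(y), sup_{y ≥ x−v+t} Ḡ(y−t)/Ḡ(y) }`. -/
theorem conv_tail_ratio_le {Ω : Type*} [MeasurableSpace Ω] (P : Measure Ω)
    [IsProbabilityMeasure P] (X Y : Ω → ℝ) (hX : Measurable X) (hY : Measurable Y)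
    (hXY : IndepFun X Y P)
    (hF : ∀ x : ℝ, 0 < P {ω | x < X ω}) (hG : ∀ x : ℝ, 0 < P {ω | x < Y ω})
    (x v t : ℝ) (ht : 0 < t) :
    P {ω | x - t < X ω + Y ω} / P {ω | x < X ω + Y ω} ≤
      max (⨆ y ∈ Set.Ici v, P {ω | y - t < X ω} / P {ω | y < X ω})
        (⨆ y ∈ Set.Ici (x - v + t), P {ω | y - t < Y ω} / P {ω | y < Y ω}) := by
  have hXm (z : ℝ) : P.map X (Set.Ioi z) = P {ω | z < X ω} :=
    Measure.map_apply hX measurableSet_Ioi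
  have hYm (z : ℝ) : P.map Y (Set.Ioi z) = P {ω | z < Y ω} :=
    Measure.map_apply hY measurableSet_Ioi
  have hsum (z : ℝ) : P {ω | z < X ω + Y ω} =
      (P.map X).prod (P.map Y) {p | z < p.1 + p.2} := by
    rw [← (indepFun_iff_map_prod_eq_prod_map_map hX.aemeasurable hY.aemeasurable).1 hXY]
    exact (Measure.map_apply (hX.prodMk hY)
      (measurableSet_lt measurable_const (measurable_fst.add measurable_snd))).symm
  have := Measure.isProbabilityMeasure_map (μ := P) hX.aemeasurable
  have := Measure.isProbabilityMeasure_map (μ := P) hY.aemeasurable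
  apply ENNReal.div_le_of_le_mul
  rw [hsum, hsum]
  refine prod_tail_sum_le_mul (v := v) ?_ (fun y hy => ?_) (fun y hy => ?_)
  · refine le_max_of_le_left (le_iSup₂_of_le v Set.self_mem_Ici ?_)
    rw [ENNReal.le_div_iff_mul_le (.inl (hF v).ne') (.inl (measure_ne_top _ _)), one_mul]
    exact measure_mono fun ω (hω : v < X ω) => show v - t < X ω by linarith
  · rw [hXm, hXm, ← ENNReal.div_le_iff (hF y).ne' (measure_ne_top _ _)]
    exact le_max_of_le_left (le_iSup₂_of_le y hy le_rfl)
  · rw [hYm, hYm, ← ENNReal.div_le_iff (hG y).ne' (measure_ne_top _ _)]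
    exact le_max_of_le_right (le_iSup₂_of_le y hy le_rfl)
end
end

section
/- Let X₁ and X₂ be independent real random variables with distribution functions F_{X₁} and F_{X₂}. If F_{X₁} belongs to the class 𝒪ℒ and lim_{x→∞} F̄_{X₂}(x)/F̄_{X₁}(x) = 0, then the distribution function F_{X₁}∗F_{X₂} of the sum X₁ + X₂ belongs to the class 𝒪ℒ. -/
open MeasureTheory ProbabilityTheory Filter

noncomputable section

/-- The distribution function of a real random variable `X`. -/
def df {Ω : Type*} [MeasurableSpace Ω] (P : Measure Ω) (X : Ω → ℝ) : ℝ → ℝ :=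
  fun x => (P {ω | X ω ≤ x}).toReal

/-- `F` belongs to the class `𝒪ℒ` of `𝒪`-exponential distribution functions:
for every `a ∈ ℝ`, `0 < liminf_{x→∞} F̄(x+a)/F̄(x)` and `limsup_{x→∞} F̄(x+a)/F̄(x) < ∞`,
where `F̄ = 1 - F`. -/
def MemOL (F : ℝ → ℝ) : Prop :=
  ∀ a : ℝ,
    (∃ c : ℝ, 0 < c ∧ ∀ᶠ x in atTop, c ≤ (1 - F (x + a)) / (1 - F x)) ∧
    (∃ C : ℝ, ∀ᶠ x in atTop, (1 - F (x + a)) / (1 - F x) ≤ C)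

section Tail

variable {Ω : Type*} [MeasurableSpace Ω] {P : Measure Ω} [IsProbabilityMeasure P]

lemma one_sub_df {X : Ω → ℝ} (hX : Measurable X) (x : ℝ) :
    1 - df P X x = P.real {ω | x < X ω} := by
  have h : {ω | x < X ω} = {ω | X ω ≤ x}ᶜ := by ext; simp
  rw [h, probReal_compl_eq_one_sub (measurableSet_le hX measurable_const)]
  rfl

/-- The tail of a sum of independent variables is the average of the shifted tails of the first
summand. -/
lemma measure_lt_add_eq_lintegral {X Y : Ω → ℝ} (hX : Measurable X) (hY : Measurable Y)
    (hind : IndepFun X Y P) (x : ℝ) :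
    P {ω | x < X ω + Y ω} = ∫⁻ y, P {ω | x - y < X ω} ∂(P.map Y) := by
  have hs : MeasurableSet {p : ℝ × ℝ | x < p.1 + p.2} :=
    measurableSet_lt measurable_const (measurable_fst.add measurable_snd)
  have hmap := (indepFun_iff_map_prod_eq_prod_map_map hX.aemeasurable hY.aemeasurable).1 hind
  have : IsProbabilityMeasure (P.map X) := Measure.isProbabilityMeasure_map hX.aemeasurable
  have : IsProbabilityMeasure (P.map Y) := Measure.isProbabilityMeasure_map hY.aemeasurable
  have h := Measure.map_apply (μ := P) (hX.prodMk hY) hs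
  rw [hmap, Measure.prod_apply_symm hs] at h
  refine h.symm.trans (lintegral_congr fun y => ?_)
  rw [Measure.map_apply hX (measurable_prodMk_right hs)]
  congr 1
  ext ω
  simp [sub_lt_iff_lt_add]

lemma MemOL.measure_lt_pos {X : Ω → ℝ} (hX : Measurable X) (h : MemOL (df P X)) (x : ℝ) :
    0 < P.real {ω | x < X ω} := by
  obtain ⟨⟨c, hc, hev⟩, -⟩ := h 0
  obtain ⟨y, hy, hxy⟩ := (hev.and (eventually_ge_atTop x)).exists
  have hne : 1 - df P X y ≠ 0 := by
    intro h0
    rw [h0, div_zero] at hy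
    exact hc.not_ge hy
  rw [one_sub_df hX] at hne
  exact (measureReal_nonneg.lt_of_ne' hne).trans_le
    (measureReal_mono fun ω (hω : y < X ω) => hxy.trans_lt hω)

/-- For a distribution function in `𝒪ℒ` the shift bound on the tail holds on the whole line. -/
lemma MemOL.exists_measure_lt_sub_le {X : Ω → ℝ} (hX : Measurable X) (h : MemOL (df P X)) (a : ℝ) :
    ∃ C : ℝ, 0 < C ∧ ∀ x, P.real {ω | x - a < X ω} ≤ C * P.real {ω | x < X ω} := by
  obtain ⟨C, hC⟩ := (h (-a)).2
  obtain ⟨x₀, hx₀⟩ := eventually_atTop.1 hC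
  have hpos := h.measure_lt_pos hX
  refine ⟨max C (P.real {ω | x₀ < X ω})⁻¹, lt_max_of_lt_right (inv_pos.2 (hpos x₀)), fun x => ?_⟩
  rcases le_total x₀ x with hx | hx
  · have hr := hx₀ x hx
    rw [one_sub_df hX, one_sub_df hX, div_le_iff₀ (hpos x), ← sub_eq_add_neg] at hr
    exact hr.trans (mul_le_mul_of_nonneg_right (le_max_left _ _) (hpos x).le)
  · have hmono : P.real {ω | x₀ < X ω} ≤ P.real {ω | x < X ω} :=
      measureReal_mono fun ω (hω : x₀ < X ω) => hx.trans_lt hω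
    calc P.real {ω | x - a < X ω} ≤ 1 := measureReal_le_one
      _ = (P.real {ω | x₀ < X ω})⁻¹ * P.real {ω | x₀ < X ω} := (inv_mul_cancel₀ (hpos x₀).ne').symm
      _ ≤ _ := mul_le_mul (le_max_right _ _) hmono (hpos x₀).le
        ((inv_pos.2 (hpos x₀)).le.trans (le_max_right _ _))

lemma memOL_df_of_forall_measure_lt_sub_le {X : Ω → ℝ} (hX : Measurable X)
    (hpos : ∀ x, 0 < P.real {ω | x < X ω})
    (h : ∀ a : ℝ, ∃ C : ℝ, 0 < C ∧ ∀ x, P.real {ω | x - a < X ω} ≤ C * P.real {ω | x < X ω}) :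
    MemOL (df P X) := by
  intro a
  simp only [one_sub_df hX]
  obtain ⟨C, hC, hCx⟩ := h a
  obtain ⟨D, -, hDx⟩ := h (-a)
  refine ⟨⟨C⁻¹, inv_pos.2 hC, Eventually.of_forall fun x => ?_⟩,
    D, Eventually.of_forall fun x => ?_⟩
  · have hx := hCx (x + a)
    rw [add_sub_cancel_right] at hx
    rwa [le_div_iff₀ (hpos x), inv_mul_le_iff₀ hC]
  · have hx := hDx x
    rw [sub_neg_eq_add] at hx
    rwa [div_le_iff₀ (hpos x)]

/-- Adding any independent random variable preserves membership in `𝒪ℒ`. -/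
lemma MemOL.df_add {X Y : Ω → ℝ} (hX : Measurable X) (hY : Measurable Y)
    (hind : IndepFun X Y P) (h : MemOL (df P X)) : MemOL (df P fun ω => X ω + Y ω) := by
  have : IsProbabilityMeasure (P.map Y) := Measure.isProbabilityMeasure_map hY.aemeasurable
  have hmeas (x : ℝ) : Measurable fun y => P {ω | x - y < X ω} :=
    Monotone.measurable fun y z hyz => measure_mono fun ω (hω : x - y < X ω) =>
      (sub_le_sub_left hyz x).trans_lt hω
  refine memOL_df_of_forall_measure_lt_sub_le (hX.add hY) (fun x => ?_) fun a => ?_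
  · refine ENNReal.toReal_pos (fun h0 => ?_) (measure_ne_top _ _)
    rw [measure_lt_add_eq_lintegral hX hY hind, lintegral_eq_zero_iff (hmeas x)] at h0
    obtain ⟨y, hy⟩ := h0.exists
    exact (ENNReal.toReal_pos_iff.1 (h.measure_lt_pos hX (x - y))).1.ne' hy
  · obtain ⟨C, hC, hCx⟩ := h.exists_measure_lt_sub_le hX a
    refine ⟨C, hC, fun x => ?_⟩
    have key : P {ω | x - a < X ω + Y ω} ≤ ENNReal.ofReal C * P {ω | x < X ω + Y ω} := by
      rw [measure_lt_add_eq_lintegral hX hY hind, measure_lt_add_eq_lintegral hX hY hind,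
        ← lintegral_const_mul _ (hmeas x)]
      refine lintegral_mono fun y => ?_
      have hy := ENNReal.ofReal_le_ofReal (hCx (x - y))
      rwa [ENNReal.ofReal_mul hC.le, ofReal_measureReal, ofReal_measureReal, sub_right_comm] at hy
    have hr := ENNReal.toReal_mono (ENNReal.mul_ne_top ENNReal.ofReal_ne_top (measure_ne_top _ _)) key
    rwa [ENNReal.toReal_mul, ENNReal.toReal_ofReal hC.le] at hr

end Tail

/-- If `X₁`, `X₂` are independent, `F_{X₁} ∈ 𝒪ℒ` and `F̄_{X₂}(x)/F̄_{X₁}(x) → 0` as `x → ∞`,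
then the distribution function `F_{X₁} ∗ F_{X₂}` of `X₁ + X₂` belongs to `𝒪ℒ`. -/
theorem ol_conv_of_negligible {Ω : Type*} [MeasurableSpace Ω] (P : Measure Ω)
    [IsProbabilityMeasure P] (X₁ X₂ : Ω → ℝ) (h₁ : Measurable X₁) (h₂ : Measurable X₂)
    (hind : IndepFun X₁ X₂ P) (hOL : MemOL (df P X₁))
    (hlim : Tendsto (fun x => (1 - df P X₂ x) / (1 - df P X₁ x)) atTop (nhds 0)) :
    MemOL (df P fun ω => X₁ ω + X₂ ω) := by
  exact hOL.df_add h₁ h₂ hind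
end
end
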